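/- For every θ₁, θ₂ ∈ ℝ and σ₁, σ₂ ∈ (0,1) with σ₁ + σ₂ < α₂, θ₁ + σ₁/α₂ > 0 and θ₂ + σ₂/α₂ > 0, there exists a constant c > 0 such that for all t ∈ (0,1] and all x, y ∈ ℝ^d: ∫₀ᵗ ∫_{ℝ^d} ρ_{θ₁}^{z,σ₁}(t−s, x−z) ρ_{θ₂}^{y,σ₂}(s, z−y) dz ds ≤ c · B(σ₁/α₂ + θ₁, σ₂/α₂ + θ₂) · [ ρ_{θ₁+θ₂+(σ₁+σ₂)/α₂}^{y,0}(t, x−y) + ρ_{θ₁+θ₂+σ₁/α₂}^{y,σ₂}(t, x−y) + ρ_{θ₁+θ₂+σ₂/α₂}^{y,σ₁}(t, x−y) ], where B denotes the Beta function. -/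

import Mathlib

open MeasureTheory Real Set

noncomputable def rho (d : ℕ) (α : EuclideanSpace ℝ (Fin d) → ℝ) (α₁ : ℝ)
    (γ : ℝ) (y : EuclideanSpace ℝ (Fin d)) (β : ℝ) (t : ℝ)
    (x : EuclideanSpace ℝ (Fin d)) : ℝ :=
  t ^ γ * min (‖x‖ ^ β) 1 *
    (if ‖x‖ ≤ 1 then (t ^ (1 / α y) + ‖x‖) ^ (-((d : ℝ) + α y))
     else ‖x‖ ^ (-((d : ℝ) + α₁)))

/-- The Beta function `B(a,b) = Γ(a)Γ(b)/Γ(a+b)`. -/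
noncomputable def betaFn (a b : ℝ) : ℝ :=
  Real.Gamma a * Real.Gamma b / Real.Gamma (a + b)

/-- The spatial factor of `rho` as a function of the index `a`, time `t` and radius `r`. -/
noncomputable def kernelProfile (D α₁ a t r : ℝ) : ℝ :=
  if r ≤ 1 then (t ^ (1 / a) + r) ^ (-(D + a)) else r ^ (-(D + α₁))

/-- The small-time limit of `kernelProfile`. -/
noncomputable def tailProfile (D α₁ a r : ℝ) : ℝ :=
  if r ≤ 1 then r ^ (-(D + a)) else r ^ (-(D + α₁))

lemma kernelProfile_nonneg {D α₁ a t r : ℝ} (ht : 0 ≤ t) (hr : 0 ≤ r) :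
    0 ≤ kernelProfile D α₁ a t r := by
  unfold kernelProfile
  split_ifs <;> positivity

lemma kernelProfile_le_peak {D α₁ a t r : ℝ} (hD : 0 ≤ D) (h1 : 0 < α₁) (ha : 0 < a)
    (ht : 0 < t) (ht1 : t ≤ 1) (hr : 0 ≤ r) :
    kernelProfile D α₁ a t r ≤ (t ^ (1 / a)) ^ (-(D + a)) := by
  have hT : 0 < t ^ (1 / a) := rpow_pos_of_pos ht _
  have hT1 : t ^ (1 / a) ≤ 1 := rpow_le_one ht.le ht1 (by positivity)
  unfold kernelProfile
  split_ifs with h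
  · exact rpow_le_rpow_of_nonpos hT (by linarith) (by linarith)
  · exact (rpow_le_one_of_one_le_of_nonpos (not_le.1 h).le (by linarith)).trans
      (one_le_rpow_of_pos_of_le_one_of_nonpos hT hT1 (by linarith))

lemma kernelProfile_le_tail {D α₁ a t r : ℝ} (hD : 0 ≤ D) (ha : 0 < a)
    (ht : 0 < t) (hr : 0 < r) :
    kernelProfile D α₁ a t r ≤ tailProfile D α₁ a r := by
  have hT : 0 < t ^ (1 / a) := rpow_pos_of_pos ht _
  unfold kernelProfile tailProfile
  split_ifs with h
  · exact rpow_le_rpow_of_nonpos hr (by linarith) (by linarith)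
  · exact le_rfl

lemma rpow_neg_le_two_rpow_mul {D a b u v : ℝ} (hD : 0 ≤ D) (ha : 0 < a) (hab : a ≤ b)
    (hu : 0 < u) (hv : 0 < v) (huv : v ≤ 2 * u) :
    u ^ (-(D + a)) ≤ 2 ^ (D + b) * v ^ (-(D + a)) := by
  have hle : (2 * u) ^ (-(D + a)) ≤ v ^ (-(D + a)) :=
    rpow_le_rpow_of_nonpos hv huv (by linarith)
  rw [mul_rpow (by norm_num) hu.le] at hle
  have hle2 : (2 : ℝ) ^ (D + a) ≤ 2 ^ (D + b) :=
    rpow_le_rpow_of_exponent_le (by norm_num) (by linarith)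
  have hone : (2 : ℝ) ^ (D + a) * 2 ^ (-(D + a)) = 1 := by
    rw [← rpow_add (by norm_num)]; simp
  calc u ^ (-(D + a)) = 2 ^ (D + a) * (2 ^ (-(D + a)) * u ^ (-(D + a))) := by
        rw [← mul_assoc, hone, one_mul]
    _ ≤ 2 ^ (D + b) * v ^ (-(D + a)) := by gcongr

lemma peak_le_kernelProfile {D α₁ α₂ a t r : ℝ} (hD : 0 ≤ D) (ha : 0 < a) (ha2 : a ≤ α₂)
    (ht : 0 < t) (ht1 : t ≤ 1) (hr : 0 ≤ r) (hrt : r ≤ t ^ (1 / a)) :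
    (t ^ (1 / a)) ^ (-(D + a)) ≤ 2 ^ (D + α₂) * kernelProfile D α₁ a t r := by
  have hT : 0 < t ^ (1 / a) := rpow_pos_of_pos ht _
  have hT1 : t ^ (1 / a) ≤ 1 := rpow_le_one ht.le ht1 (by positivity)
  rw [kernelProfile, if_pos (hrt.trans hT1)]
  exact rpow_neg_le_two_rpow_mul hD ha ha2 hT (by linarith) (by linarith)

lemma tail_le_kernelProfile {D α₁ α₂ a t r : ℝ} (hD : 0 ≤ D) (ha : 0 < a) (ha2 : a ≤ α₂)
    (ht : 0 < t) (hrt : t ^ (1 / a) < r) :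
    tailProfile D α₁ a r ≤ 2 ^ (D + α₂) * kernelProfile D α₁ a t r := by
  have hT : 0 < t ^ (1 / a) := rpow_pos_of_pos ht _
  have hr : 0 < r := hT.trans hrt
  unfold kernelProfile tailProfile
  split_ifs with h
  · exact rpow_neg_le_two_rpow_mul hD ha ha2 hr (by linarith) (by linarith)
  · exact le_mul_of_one_le_left (rpow_nonneg hr.le _)
      (one_le_rpow (by norm_num) (by linarith))

lemma tailProfile_doubling {D α₁ α₂ a r r' : ℝ} (hD : 0 ≤ D) (h1 : 0 < α₁) (ha : α₁ ≤ a)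
    (ha2 : a ≤ α₂) (hr : 0 < r) (hr' : r ≤ 2 * r') :
    tailProfile D α₁ a r' ≤ 2 ^ (D + α₂) * tailProfile D α₁ a r := by
  have hpos : 0 < r' := by linarith
  have hbase := rpow_neg_le_two_rpow_mul hD (h1.trans_le ha) ha2 hpos hr hr'
  have hone : (1 : ℝ) ≤ 2 ^ (D + α₂) := one_le_rpow (by norm_num) (by linarith)
  unfold tailProfile
  split_ifs with h h' h'
  · exact hbase
  · refine hbase.trans (mul_le_mul_of_nonneg_left ?_ (by positivity))
    exact rpow_le_rpow_of_exponent_le (not_le.1 h').le (by linarith)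
  · calc r' ^ (-(D + α₁)) ≤ 1 * 1 := by
          rw [one_mul]
          exact rpow_le_one_of_one_le_of_nonpos (not_le.1 h).le (by linarith)
      _ ≤ _ := mul_le_mul hone
          (one_le_rpow_of_pos_of_le_one_of_nonpos hr h' (by linarith)) zero_le_one (by positivity)
  · exact rpow_neg_le_two_rpow_mul hD h1 (ha.trans ha2) hpos hr hr'

lemma rpow_neg_le_exp_mul_of_abs_sub_le {t u v M ε : ℝ} (ht : 0 < t) (ht1 : t ≤ 1)
    (hM : 0 ≤ M) (hε : 0 < ε) (h : |u - v| ≤ M * t ^ ε) :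
    t ^ (-u) ≤ exp (M / ε) * t ^ (-v) := by
  have hlog : |log t * t ^ ε| ≤ 1 / ε := (abs_log_mul_self_rpow_lt t ε ht ht1 hε).le
  rw [abs_mul, abs_of_pos (rpow_pos_of_pos ht ε)] at hlog
  rw [rpow_def_of_pos ht, rpow_def_of_pos ht, ← exp_add]
  apply exp_le_exp.2
  have : log t * (v - u) ≤ M / ε := calc
    log t * (v - u) ≤ |log t| * |u - v| := by
        rw [abs_sub_comm, ← abs_mul]; exact le_abs_self _
    _ ≤ |log t| * (M * t ^ ε) := by gcongr
    _ = M * (|log t| * t ^ ε) := by ring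
    _ ≤ M * (1 / ε) := by gcongr
    _ = M / ε := by ring
  linarith

lemma tailProfile_le_of_abs_sub_le {D α₁ a b r c β : ℝ} (hr : 0 < r) (hc : 0 ≤ c) (hβ : 0 < β)
    (h : |a - b| ≤ c * min (r ^ β) 1) :
    tailProfile D α₁ a r ≤ exp (c / β) * tailProfile D α₁ b r := by
  unfold tailProfile
  split_ifs with h'
  · refine rpow_neg_le_exp_mul_of_abs_sub_le hr h' hc hβ ?_
    rw [add_sub_add_left_eq_sub]
    exact h.trans (mul_le_mul_of_nonneg_left (min_le_left _ _) hc)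
  · exact le_mul_of_one_le_left (rpow_nonneg hr.le _) (one_le_exp (by positivity))

lemma rpow_peak_eq {D a t : ℝ} (ha : 0 < a) (ht : 0 < t) :
    (t ^ (1 / a)) ^ (-(D + a)) = t ^ (-(D / a + 1)) := by
  rw [← rpow_mul ht.le]
  congr 1
  field_simp

lemma peak_le_of_abs_sub_le {D α₁ α₂ a b t r c β : ℝ} (hD : 0 ≤ D) (h1 : 0 < α₁)
    (ha : a ∈ Icc α₁ α₂) (hb : b ∈ Icc α₁ α₂) (ht : 0 < t) (ht1 : t ≤ 1) (hr : 0 ≤ r)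
    (hc : 0 ≤ c) (hβ : 0 < β) (h : |a - b| ≤ c * min (r ^ β) 1) (hrt : r ≤ t ^ (1 / b)) :
    (t ^ (1 / a)) ^ (-(D + a)) ≤
      exp (D * c / α₁ ^ 2 / (β / α₂)) * (t ^ (1 / b)) ^ (-(D + b)) := by
  have ha0 : 0 < a := h1.trans_le ha.1
  have hb0 : 0 < b := h1.trans_le hb.1
  have h20 : 0 < α₂ := hb0.trans_le hb.2
  rw [rpow_peak_eq ha0 ht, rpow_peak_eq hb0 ht]
  refine rpow_neg_le_exp_mul_of_abs_sub_le ht ht1 (by positivity) (by positivity) ?_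
  have hrt2 : r ^ β ≤ t ^ (β / α₂) := by
    have : r ≤ t ^ (1 / α₂) := hrt.trans
      (rpow_le_rpow_of_exponent_ge ht ht1 (one_div_le_one_div_of_le hb0 hb.2))
    calc r ^ β ≤ (t ^ (1 / α₂)) ^ β := by gcongr
      _ = t ^ (β / α₂) := by rw [← rpow_mul ht.le]; congr 1; ring
  have hab : |a - b| ≤ c * t ^ (β / α₂) :=
    h.trans (mul_le_mul_of_nonneg_left ((min_le_left _ _).trans hrt2) hc)
  have hmul : α₁ ^ 2 ≤ a * b := by
    rw [sq]; exact mul_le_mul ha.1 hb.1 h1.le ha0.le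
  have heq : D / a + 1 - (D / b + 1) = D * (b - a) / (a * b) := by field_simp; ring
  rw [heq, abs_div, abs_mul, abs_of_nonneg hD, abs_of_pos (mul_pos ha0 hb0), abs_sub_comm]
  calc D * |a - b| / (a * b) ≤ D * (c * t ^ (β / α₂)) / α₁ ^ 2 := by gcongr
    _ = D * c / α₁ ^ 2 * t ^ (β / α₂) := by ring

/-- The profile changes at most by a constant factor when its index is moved between two points
at distance `r` at which a Hölder continuous index takes the values `a` and `b`. -/
lemma exists_kernelProfile_le_of_abs_sub_le {D α₁ α₂ c β : ℝ} (hD : 0 ≤ D) (h1 : 0 < α₁)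
    (hc : 0 ≤ c) (hβ : 0 < β) :
    ∃ C > 0, ∀ a ∈ Icc α₁ α₂, ∀ b ∈ Icc α₁ α₂, ∀ t ∈ Ioc (0 : ℝ) 1, ∀ r, 0 ≤ r →
      |a - b| ≤ c * min (r ^ β) 1 →
      kernelProfile D α₁ a t r ≤ C * kernelProfile D α₁ b t r := by
  refine ⟨(exp (D * c / α₁ ^ 2 / (β / α₂)) + exp (c / β)) * 2 ^ (D + α₂), by positivity, ?_⟩
  rintro a ha b hb t ⟨ht, ht1⟩ r hr hab
  have ha0 : 0 < a := h1.trans_le ha.1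
  have hb0 : 0 < b := h1.trans_le hb.1
  have hk : 0 ≤ kernelProfile D α₁ b t r := kernelProfile_nonneg ht.le hr
  rcases le_or_gt r (t ^ (1 / b)) with hrt | hrt
  · calc kernelProfile D α₁ a t r ≤ _ := kernelProfile_le_peak hD h1 ha0 ht ht1 hr
      _ ≤ _ := peak_le_of_abs_sub_le hD h1 ha hb ht ht1 hr hc hβ hab hrt
      _ ≤ exp (D * c / α₁ ^ 2 / (β / α₂)) * (2 ^ (D + α₂) * kernelProfile D α₁ b t r) := by
        gcongr
        exact peak_le_kernelProfile hD hb0 hb.2 ht ht1 hr hrt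
      _ ≤ (exp (D * c / α₁ ^ 2 / (β / α₂)) + exp (c / β)) *
          (2 ^ (D + α₂) * kernelProfile D α₁ b t r) := by
        gcongr
        exact le_add_of_nonneg_right (exp_pos _).le
      _ = _ := by ring
  · have hr0 : 0 < r := (rpow_pos_of_pos ht _).trans hrt
    calc kernelProfile D α₁ a t r ≤ _ := kernelProfile_le_tail hD ha0 ht hr0
      _ ≤ _ := tailProfile_le_of_abs_sub_le hr0 hc hβ hab
      _ ≤ exp (c / β) * (2 ^ (D + α₂) * kernelProfile D α₁ b t r) := by
        gcongr
        exact tail_le_kernelProfile hD hb0 hb.2 ht hrt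
      _ ≤ (exp (D * c / α₁ ^ 2 / (β / α₂)) + exp (c / β)) *
          (2 ^ (D + α₂) * kernelProfile D α₁ b t r) := by
        gcongr
        exact le_add_of_nonneg_left (exp_pos _).le
      _ = _ := by ring

lemma peak_half_le {D α₁ a s t : ℝ} (hD : 0 ≤ D) (h1 : 0 < α₁) (ha : α₁ ≤ a) (ht : 0 < t)
    (hst : t ≤ 2 * s) :
    (s ^ (1 / a)) ^ (-(D + a)) ≤ 2 ^ (D / α₁ + 1) * (t ^ (1 / a)) ^ (-(D + a)) := by
  have ha0 : 0 < a := h1.trans_le ha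
  have hs : 0 < s := by linarith
  rw [rpow_peak_eq ha0 ht, rpow_peak_eq ha0 hs]
  have hda : 0 ≤ D / a := by positivity
  have hle : (2 * s) ^ (-(D / a + 1)) ≤ t ^ (-(D / a + 1)) :=
    rpow_le_rpow_of_nonpos ht hst (by linarith)
  rw [mul_rpow (by norm_num) hs.le] at hle
  have hle2 : (2 : ℝ) ^ (D / a + 1) ≤ 2 ^ (D / α₁ + 1) :=
    rpow_le_rpow_of_exponent_le (by norm_num) (by gcongr)
  have hone : (2 : ℝ) ^ (D / a + 1) * 2 ^ (-(D / a + 1)) = 1 := by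
    rw [← rpow_add (by norm_num)]; simp
  calc s ^ (-(D / a + 1)) = 2 ^ (D / a + 1) * (2 ^ (-(D / a + 1)) * s ^ (-(D / a + 1))) := by
        rw [← mul_assoc, hone, one_mul]
    _ ≤ 2 ^ (D / α₁ + 1) * t ^ (-(D / a + 1)) := by gcongr

/-- Splitting time and space in two, at least one of the two pieces is dominated by the whole. -/
lemma exists_kernelProfile_le_or_le {D α₁ α₂ c β : ℝ} (hD : 0 ≤ D) (h1 : 0 < α₁)
    (h2 : 0 < α₂) (hc : 0 ≤ c) (hβ : 0 < β) :
    ∃ C > 0, ∀ a ∈ Icc α₁ α₂, ∀ b ∈ Icc α₁ α₂, ∀ s > 0, ∀ s' > 0, s + s' ≤ 1 →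
      ∀ r u v, 0 ≤ r → 0 ≤ u → 0 ≤ v → r ≤ u + v → |a - b| ≤ c * min (r ^ β) 1 →
      kernelProfile D α₁ a s' u ≤ C * kernelProfile D α₁ b (s' + s) r ∨
      kernelProfile D α₁ b s v ≤ C * kernelProfile D α₁ b (s' + s) r := by
  set A := exp (D * c / α₁ ^ 2 / (β / α₂))
  set B := exp (c / β)
  set P : ℝ := 2 ^ (D / α₁ + 1)
  set Q : ℝ := 2 ^ (D + α₂)
  have hA : 1 ≤ A := one_le_exp (by positivity)
  have hB : 1 ≤ B := one_le_exp (by positivity)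
  have hP : 0 < P := by positivity
  have hQ : 0 < Q := by positivity
  refine ⟨P * A * Q + Q * B * Q, by positivity, ?_⟩
  rintro a ha b hb s hs s' hs' hss r u v hr hu hv huv hab
  have ha0 : 0 < a := h1.trans_le ha.1
  have hb0 : 0 < b := h1.trans_le hb.1
  have ht : 0 < s' + s := by linarith
  set K := kernelProfile D α₁ b (s' + s) r
  have hK : 0 ≤ K := kernelProfile_nonneg ht.le hr
  have hPAQ : 0 ≤ P * A * Q * K := by positivity
  have hQBQ : 0 ≤ Q * B * Q * K := by positivity
  rw [add_mul]
  rcases le_or_gt r ((s' + s) ^ (1 / b)) with hrt | hrt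
  · have hpeak : ((s' + s) ^ (1 / b)) ^ (-(D + b)) ≤ Q * K :=
      peak_le_kernelProfile hD hb0 hb.2 ht (by linarith) hr hrt
    rcases le_total s s' with h | h
    · left
      calc kernelProfile D α₁ a s' u ≤ _ := kernelProfile_le_peak hD h1 ha0 hs' (by linarith) hu
        _ ≤ P * ((s' + s) ^ (1 / a)) ^ (-(D + a)) := peak_half_le hD h1 ha.1 ht (by linarith)
        _ ≤ P * (A * ((s' + s) ^ (1 / b)) ^ (-(D + b))) := by
          gcongr
          exact peak_le_of_abs_sub_le hD h1 ha hb ht (by linarith) hr hc hβ hab hrt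
        _ ≤ P * (A * (Q * K)) := by gcongr
        _ ≤ _ := by linarith
    · right
      calc kernelProfile D α₁ b s v ≤ _ := kernelProfile_le_peak hD h1 hb0 hs (by linarith) hv
        _ ≤ P * ((s' + s) ^ (1 / b)) ^ (-(D + b)) := peak_half_le hD h1 hb.1 ht (by linarith)
        _ ≤ P * (1 * (Q * K)) := by rw [one_mul]; gcongr
        _ ≤ P * (A * (Q * K)) := by gcongr
        _ ≤ _ := by linarith
  · have hr0 : 0 < r := (rpow_pos_of_pos ht _).trans hrt
    have htail : tailProfile D α₁ b r ≤ Q * K := tail_le_kernelProfile hD hb0 hb.2 ht hrt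
    rcases le_total v u with h | h
    · left
      calc kernelProfile D α₁ a s' u ≤ _ := kernelProfile_le_tail hD ha0 hs' (by linarith)
        _ ≤ Q * tailProfile D α₁ a r := tailProfile_doubling hD h1 ha.1 ha.2 hr0 (by linarith)
        _ ≤ Q * (B * tailProfile D α₁ b r) := by
          gcongr
          exact tailProfile_le_of_abs_sub_le hr0 hc hβ hab
        _ ≤ Q * (B * (Q * K)) := by gcongr
        _ ≤ _ := by linarith
    · right
      calc kernelProfile D α₁ b s v ≤ _ := kernelProfile_le_tail hD hb0 hs (by linarith)
        _ ≤ Q * tailProfile D α₁ b r := tailProfile_doubling hD h1 hb.1 hb.2 hr0 (by linarith)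
        _ ≤ Q * (1 * (Q * K)) := by rw [one_mul]; gcongr
        _ ≤ Q * (B * (Q * K)) := by gcongr
        _ ≤ _ := by linarith

lemma kernelProfile_mul_min_le {D α₁ α₂ a β t r : ℝ} (hD : 0 ≤ D) (h1 : 0 < α₁)
    (ha : a ∈ Icc α₁ α₂) (hβ : 0 < β) (hβ2 : β < α₂) (ht : 0 < t) (ht1 : t ≤ 1) (hr : 0 ≤ r) :
    kernelProfile D α₁ a t r * min (r ^ β) 1 ≤ t ^ (β / α₂ - 1) *
      (2 ^ β * ((t ^ (1 / a)) ^ (-D) * (1 + (t ^ (1 / a))⁻¹ * r) ^ (-(D + α₁ * (1 - β / α₂)))) +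
        2 ^ (D + α₂) * (1 + r) ^ (-(D + α₁))) := by
  have ha0 : 0 < a := h1.trans_le ha.1
  have h20 : 0 < α₂ := ha0.trans_le ha.2
  have hfrac : β / α₂ < 1 := (div_lt_one h20).2 hβ2
  have hT : 0 < t ^ (1 / a) := rpow_pos_of_pos ht _
  have hT1 : t ^ (1 / a) ≤ 1 := rpow_le_one ht.le ht1 (by positivity)
  have hTpow : (t ^ (1 / a)) ^ (-(a * (1 - β / α₂))) = t ^ (β / α₂ - 1) := by
    rw [← rpow_mul ht.le]; congr 1; field_simp; ring
  set T := t ^ (1 / a) with hTdef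
  rw [mul_add]
  rcases le_or_gt r 1 with h | h
  · refine le_add_of_le_of_nonneg ?_ (by positivity)
    rw [kernelProfile, if_pos h, ← hTdef]
    have hTr : 0 < T + r := by linarith
    have hκ : 0 ≤ β * (1 - a / α₂) :=
      mul_nonneg hβ.le (sub_nonneg.2 ((div_le_one h20).2 ha.2))
    have hκβ : β * (1 - a / α₂) ≤ β := by
      have : 0 ≤ β * (a / α₂) := by positivity
      linarith
    have hge : 1 ≤ 1 + T⁻¹ * r := le_add_of_nonneg_right (by positivity)
    calc (T + r) ^ (-(D + a)) * min (r ^ β) 1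
        ≤ (T + r) ^ (-(D + a)) * (T + r) ^ β := by
          gcongr
          exact (min_le_left _ _).trans (rpow_le_rpow hr (by linarith) hβ.le)
      _ = (T + r) ^ (β * (1 - a / α₂)) * (T + r) ^ (-(D + a * (1 - β / α₂))) := by
          rw [← rpow_add hTr, ← rpow_add hTr]; congr 1; field_simp; ring
      _ ≤ 2 ^ β * (T + r) ^ (-(D + a * (1 - β / α₂))) := by
          gcongr
          calc (T + r) ^ (β * (1 - a / α₂)) ≤ 2 ^ (β * (1 - a / α₂)) :=
                rpow_le_rpow hTr.le (by linarith) hκ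
            _ ≤ 2 ^ β := rpow_le_rpow_of_exponent_le (by norm_num) hκβ
      _ = 2 ^ β * (T ^ (-D) * t ^ (β / α₂ - 1) *
            (1 + T⁻¹ * r) ^ (-(D + a * (1 - β / α₂)))) := by
          have : T + r = T * (1 + T⁻¹ * r) := by field_simp
          rw [this, mul_rpow hT.le (by positivity), ← hTpow, ← rpow_add hT]
          congr 4; ring
      _ ≤ 2 ^ β * (T ^ (-D) * t ^ (β / α₂ - 1) *
            (1 + T⁻¹ * r) ^ (-(D + α₁ * (1 - β / α₂)))) := by
          have := mul_le_mul_of_nonneg_right ha.1 (sub_nonneg.2 hfrac.le)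
          gcongr
      _ = _ := by ring
  · refine le_add_of_nonneg_of_le (by positivity) ?_
    rw [kernelProfile, if_neg h.not_ge]
    have hone : 1 ≤ t ^ (β / α₂ - 1) :=
      one_le_rpow_of_pos_of_le_one_of_nonpos ht ht1 (by linarith)
    calc r ^ (-(D + α₁)) * min (r ^ β) 1 ≤ r ^ (-(D + α₁)) * 1 := by
          gcongr
          exact min_le_right _ _
      _ ≤ 1 * (2 ^ (D + α₂) * (1 + r) ^ (-(D + α₁))) := by
          rw [mul_one, one_mul]
          exact rpow_neg_le_two_rpow_mul hD h1 (ha.1.trans ha.2) (by linarith) (by linarith)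
            (by linarith)
      _ ≤ _ := by gcongr

section LIntegral

variable {X : Type*} [MeasurableSpace X] {μ : Measure X}

lemma lintegral_ofReal_add_le {f g : X → ℝ} {A B : ℝ} (hf : Measurable f) (hA : 0 ≤ A)
    (hB : 0 ≤ B) (hfA : ∫⁻ x, ENNReal.ofReal (f x) ∂μ ≤ ENNReal.ofReal A)
    (hgB : ∫⁻ x, ENNReal.ofReal (g x) ∂μ ≤ ENNReal.ofReal B) :
    ∫⁻ x, ENNReal.ofReal (f x + g x) ∂μ ≤ ENNReal.ofReal (A + B) := by
  calc ∫⁻ x, ENNReal.ofReal (f x + g x) ∂μ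
      ≤ ∫⁻ x, (ENNReal.ofReal (f x) + ENNReal.ofReal (g x)) ∂μ :=
        lintegral_mono fun x => ENNReal.ofReal_add_le
    _ = ∫⁻ x, ENNReal.ofReal (f x) ∂μ + ∫⁻ x, ENNReal.ofReal (g x) ∂μ :=
        lintegral_add_left hf.ennreal_ofReal _
    _ ≤ ENNReal.ofReal (A + B) := by
        rw [ENNReal.ofReal_add hA hB]; gcongr

lemma lintegral_ofReal_const_mul_le {f : X → ℝ} {k A : ℝ} (hk : 0 ≤ k)
    (hfA : ∫⁻ x, ENNReal.ofReal (f x) ∂μ ≤ ENNReal.ofReal A) :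
    ∫⁻ x, ENNReal.ofReal (k * f x) ∂μ ≤ ENNReal.ofReal (k * A) := by
  simp_rw [ENNReal.ofReal_mul hk]
  rw [lintegral_const_mul' _ _ ENNReal.ofReal_ne_top]
  gcongr

end LIntegral

lemma lintegral_scaled_one_add_norm {d : ℕ} {T k : ℝ} (hT : 0 < T) (hk : (d : ℝ) < k) :
    ∫⁻ z : EuclideanSpace ℝ (Fin d), ENNReal.ofReal (T ^ (-(d : ℝ)) * (1 + T⁻¹ * ‖z‖) ^ (-k)) =
      ENNReal.ofReal (∫ z : EuclideanSpace ℝ (Fin d), (1 + ‖z‖) ^ (-k)) := by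
  have hint : Integrable fun z : EuclideanSpace ℝ (Fin d) => (1 + ‖z‖) ^ (-k) :=
    integrable_one_add_norm (by simpa using hk)
  have hscale : ∀ z : EuclideanSpace ℝ (Fin d),
      (1 + T⁻¹ * ‖z‖) ^ (-k) = (1 + ‖T⁻¹ • z‖) ^ (-k) := fun z => by
    rw [norm_smul, norm_of_nonneg (inv_nonneg.2 hT.le)]
  simp_rw [hscale]
  rw [← ofReal_integral_eq_lintegral_ofReal
      (((integrable_comp_smul_iff volume (fun z : EuclideanSpace ℝ (Fin d) => (1 + ‖z‖) ^ (-k))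
        (inv_ne_zero hT.ne')).2 hint).const_mul _)
      (Filter.Eventually.of_forall fun z => by positivity),
    integral_const_mul,
    Measure.integral_comp_smul volume (fun z : EuclideanSpace ℝ (Fin d) => (1 + ‖z‖) ^ (-k)) T⁻¹]
  congr 1
  rw [finrank_euclideanSpace_fin, inv_pow, inv_inv, abs_of_pos (pow_pos hT d), smul_eq_mul,
    ← mul_assoc, rpow_neg hT.le, rpow_natCast, inv_mul_cancel₀ (pow_pos hT d).ne', one_mul]

lemma exists_lintegral_kernelProfile_le {d : ℕ} {α₁ α₂ β : ℝ} (h1 : 0 < α₁) (h12 : α₁ ≤ α₂)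
    (hβ : 0 < β) (hβ2 : β < α₂) :
    ∃ C > 0, ∀ a ∈ Icc α₁ α₂, ∀ t ∈ Ioc (0 : ℝ) 1, ∀ x : EuclideanSpace ℝ (Fin d),
      ∫⁻ z, ENNReal.ofReal (kernelProfile d α₁ a t ‖z - x‖ * min (‖z - x‖ ^ β) 1) ≤
        ENNReal.ofReal (C * t ^ (β / α₂ - 1)) := by
  have h20 : 0 < α₂ := h1.trans_le h12
  have hη : 0 < α₁ * (1 - β / α₂) := mul_pos h1 (sub_pos.2 ((div_lt_one h20).2 hβ2))
  set I : ℝ → ℝ := fun k => ∫ z : EuclideanSpace ℝ (Fin d), (1 + ‖z‖) ^ (-k)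
  have hI0 : ∀ k, 0 ≤ I k := fun k => integral_nonneg fun z => by positivity
  refine ⟨2 ^ β * I (d + α₁ * (1 - β / α₂)) + 2 ^ ((d : ℝ) + α₂) * I (d + α₁) + 1, ?_, ?_⟩
  · have := hI0 (d + α₁ * (1 - β / α₂))
    have := hI0 (d + α₁)
    positivity
  rintro a ha t ⟨ht, ht1⟩ x
  rw [lintegral_sub_right_eq_self (fun z : EuclideanSpace ℝ (Fin d) =>
    ENNReal.ofReal (kernelProfile d α₁ a t ‖z‖ * min (‖z‖ ^ β) 1)) x]
  have hT : 0 < t ^ (1 / a) := rpow_pos_of_pos ht _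
  have hnear := (lintegral_scaled_one_add_norm (d := d) hT
    (show (d : ℝ) < d + α₁ * (1 - β / α₂) by linarith)).le
  have hfar := (lintegral_scaled_one_add_norm (d := d) one_pos
    (show (d : ℝ) < d + α₁ by linarith)).le
  simp only [inv_one, one_mul, one_rpow] at hfar
  calc _ ≤ ∫⁻ z : EuclideanSpace ℝ (Fin d), ENNReal.ofReal _ :=
        lintegral_mono fun z => ENNReal.ofReal_le_ofReal
          (kernelProfile_mul_min_le d.cast_nonneg h1 ha hβ hβ2 ht ht1 (norm_nonneg z))
    _ ≤ ENNReal.ofReal (t ^ (β / α₂ - 1) *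
          (2 ^ β * I (d + α₁ * (1 - β / α₂)) + 2 ^ ((d : ℝ) + α₂) * I (d + α₁))) := by
        refine lintegral_ofReal_const_mul_le (by positivity) (lintegral_ofReal_add_le
          (by fun_prop) (mul_nonneg (by positivity) (hI0 _)) (mul_nonneg (by positivity) (hI0 _))
          (lintegral_ofReal_const_mul_le (by positivity) hnear)
          (lintegral_ofReal_const_mul_le (by positivity) hfar))
    _ ≤ _ := by
        apply ENNReal.ofReal_le_ofReal
        rw [mul_comm]
        exact mul_le_mul_of_nonneg_right (by linarith) (by positivity)

lemma rpow_mul_sub_rpow_le {s t u v : ℝ} (hs : 0 < s) (hst : s < t) :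
    s ^ u * (t - s) ^ v ≤ 2 ^ |v| * t ^ v * s ^ u + 2 ^ |u| * t ^ u * (t - s) ^ v := by
  have hcomp : ∀ x w : ℝ, x ≤ t → t ≤ 2 * x → x ^ w ≤ 2 ^ |w| * t ^ w := by
    intro x w hxt htx
    have ht : 0 < t := hs.trans hst
    have hx : 0 < x := by linarith
    rcases le_total 0 w with hw | hw
    · calc x ^ w ≤ 1 * t ^ w := by rw [one_mul]; gcongr
        _ ≤ _ := by gcongr; exact one_le_rpow (by norm_num) (abs_nonneg _)
    · calc x ^ w = 2 ^ |w| * (2 * x) ^ w := by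
            rw [mul_rpow (by norm_num) hx.le, ← mul_assoc, ← rpow_add (by norm_num),
              abs_of_nonpos hw]
            simp
        _ ≤ _ := by
            gcongr 2 ^ |w| * ?_
            exact rpow_le_rpow_of_nonpos ht htx hw
  have hts : 0 < t - s := sub_pos.2 hst
  have ht : 0 < t := hs.trans hst
  rcases le_total (2 * s) t with h | h
  · refine le_add_of_le_of_nonneg ?_ (by positivity)
    rw [mul_comm]
    gcongr
    exact hcomp _ _ (by linarith) (by linarith)
  · refine le_add_of_nonneg_of_le (by positivity) ?_
    gcongr
    exact hcomp _ _ hst.le h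

lemma lintegral_Ioo_rpow {t u : ℝ} (ht : 0 ≤ t) (hu : -1 < u) :
    ∫⁻ s in Ioo 0 t, ENNReal.ofReal (s ^ u) = ENNReal.ofReal (t ^ (u + 1) / (u + 1)) := by
  have hint : IntegrableOn (fun s : ℝ => s ^ u) (Ioo 0 t) :=
    ((intervalIntegrable_iff_integrableOn_Ioo_of_le ht).1
      (intervalIntegral.intervalIntegrable_rpow' hu))
  rw [← ofReal_integral_eq_lintegral_ofReal hint
    ((ae_restrict_iff' measurableSet_Ioo).2
      (Filter.Eventually.of_forall fun s hs => rpow_nonneg hs.1.le _)),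
    ← integral_Ioc_eq_integral_Ioo, ← intervalIntegral.integral_of_le ht,
    integral_rpow (Or.inl hu), zero_rpow (by linarith), sub_zero]

lemma lintegral_Ioo_sub_rpow {t u : ℝ} (ht : 0 ≤ t) (hu : -1 < u) :
    ∫⁻ s in Ioo 0 t, ENNReal.ofReal ((t - s) ^ u) = ENNReal.ofReal (t ^ (u + 1) / (u + 1)) := by
  rw [← lintegral_Ioo_rpow ht hu]
  have hpre : (fun s : ℝ => t - s) ⁻¹' Ioo 0 t = Ioo 0 t := by simp
  have := (Measure.measurePreserving_sub_left (volume : Measure ℝ) t).setLIntegral_comp_preimage_emb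
    (Homeomorph.subLeft t).measurableEmbedding (fun s => ENNReal.ofReal (s ^ u)) (Ioo 0 t)
  rwa [hpre] at this

lemma exists_lintegral_rpow_mul_sub_rpow_le {u v : ℝ} (hu : -1 < u) (hv : -1 < v) :
    ∃ C > 0, ∀ t > 0, ∫⁻ s in Ioo 0 t, ENNReal.ofReal (s ^ u * (t - s) ^ v) ≤
      ENNReal.ofReal (C * t ^ (u + v + 1)) := by
  have hu1 : 0 < u + 1 := by linarith
  have hv1 : 0 < v + 1 := by linarith
  refine ⟨2 ^ |v| / (u + 1) + 2 ^ |u| / (v + 1), by positivity, fun t ht => ?_⟩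
  calc _ ≤ ∫⁻ s in Ioo 0 t,
        ENNReal.ofReal (2 ^ |v| * t ^ v * s ^ u + 2 ^ |u| * t ^ u * (t - s) ^ v) :=
        setLIntegral_mono' measurableSet_Ioo fun s hs =>
          ENNReal.ofReal_le_ofReal (rpow_mul_sub_rpow_le hs.1 hs.2)
    _ ≤ ENNReal.ofReal (2 ^ |v| * t ^ v * (t ^ (u + 1) / (u + 1)) +
          2 ^ |u| * t ^ u * (t ^ (v + 1) / (v + 1))) :=
        lintegral_ofReal_add_le (by fun_prop) (by positivity) (by positivity)
          (lintegral_ofReal_const_mul_le (by positivity) (lintegral_Ioo_rpow ht.le hu).le)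
          (lintegral_ofReal_const_mul_le (by positivity) (lintegral_Ioo_sub_rpow ht.le hv).le)
    _ = _ := by
        have huv : t ^ (u + v + 1) = t ^ v * t ^ (u + 1) := by
          rw [← rpow_add ht]; congr 1; ring
        have hvu : t ^ v * t ^ (u + 1) = t ^ u * t ^ (v + 1) := by
          rw [← rpow_add ht, ← rpow_add ht]; congr 1; ring
        congr 1
        rw [huv, add_mul]
        nth_rewrite 2 [hvu]
        ring

lemma min_rpow_le_add {u v w σ : ℝ} (hu : 0 ≤ u) (hv : 0 ≤ v) (hw : 0 ≤ w) (hσ : 0 ≤ σ)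
    (hσ1 : σ ≤ 1) (h : u ≤ v + w) :
    min (u ^ σ) 1 ≤ min (v ^ σ) 1 + min (w ^ σ) 1 := by
  have hadd : u ^ σ ≤ v ^ σ + w ^ σ :=
    (rpow_le_rpow hu h hσ).trans (rpow_add_le_add_rpow hv hw hσ hσ1)
  have hv' : 0 ≤ v ^ σ := by positivity
  have hw' : 0 ≤ w ^ σ := by positivity
  rcases min_cases (v ^ σ) 1 with h₁ | h₁ <;> rcases min_cases (w ^ σ) 1 with h₂ | h₂ <;>
    rcases min_cases (u ^ σ) 1 with h₃ | h₃ <;> linarith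

lemma min_rpow_mul_min_rpow {r σ τ : ℝ} (hr : 0 ≤ r) (hσ : 0 < σ) (hτ : 0 < τ) :
    min (r ^ σ) 1 * min (r ^ τ) 1 = min (r ^ (σ + τ)) 1 := by
  rcases le_total r 1 with h | h
  · rw [min_eq_left (rpow_le_one hr h hσ.le), min_eq_left (rpow_le_one hr h hτ.le),
      min_eq_left (rpow_le_one hr h (by linarith)), rpow_add_of_nonneg hr hσ.le hτ.le]
  · rw [min_eq_right (one_le_rpow h hσ.le), min_eq_right (one_le_rpow h hτ.le),
      min_eq_right (one_le_rpow h (by linarith)), one_mul]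

lemma measurable_kernelProfile (D α₁ a t : ℝ) : Measurable (kernelProfile D α₁ a t) :=
  Measurable.ite measurableSet_Iic (by fun_prop) (by fun_prop)

/-- If one of two factors `ka`, `kb` is at most `L`, the product is bounded by a sum in which the
weight of the bounded factor has been moved to the other one. -/
lemma weighted_mul_le {ka kb L u v r σ₁ σ₂ : ℝ} (hka : 0 ≤ ka) (hkb : 0 ≤ kb) (hL : 0 ≤ L)
    (hu : 0 ≤ u) (hv : 0 ≤ v) (hr : 0 ≤ r) (hσ₁ : σ₁ ∈ Ioo (0 : ℝ) 1) (hσ₂ : σ₂ ∈ Ioo (0 : ℝ) 1)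
    (huv : u ≤ v + r) (hvu : v ≤ u + r) (hk : ka ≤ L ∨ kb ≤ L) :
    min (u ^ σ₁) 1 * ka * (min (v ^ σ₂) 1 * kb) ≤ L *
      ((ka * min (u ^ (σ₁ + σ₂)) 1 + min (r ^ σ₂) 1 * (ka * min (u ^ σ₁) 1)) +
        (kb * min (v ^ (σ₁ + σ₂)) 1 + min (r ^ σ₁) 1 * (kb * min (v ^ σ₂) 1))) := by
  have hu₁ : 0 ≤ min (u ^ σ₁) 1 := by positivity
  have hv₂ : 0 ≤ min (v ^ σ₂) 1 := by positivity
  have hr₁ : 0 ≤ min (r ^ σ₁) 1 := by positivity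
  have hr₂ : 0 ≤ min (r ^ σ₂) 1 := by positivity
  have hu₂ : 0 ≤ min (u ^ σ₂) 1 := by positivity
  have hv₁ : 0 ≤ min (v ^ σ₁) 1 := by positivity
  rw [← min_rpow_mul_min_rpow hu hσ₁.1 hσ₂.1, ← min_rpow_mul_min_rpow hv hσ₁.1 hσ₂.1]
  have hmu := min_rpow_le_add hu hv hr hσ₁.1.le hσ₁.2.le huv
  have hmv := min_rpow_le_add hv hu hr hσ₂.1.le hσ₂.2.le hvu
  generalize min (u ^ σ₁) 1 = U₁ at *
  generalize min (u ^ σ₂) 1 = U₂ at *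
  generalize min (v ^ σ₁) 1 = V₁ at *
  generalize min (v ^ σ₂) 1 = V₂ at *
  generalize min (r ^ σ₁) 1 = R₁ at *
  generalize min (r ^ σ₂) 1 = R₂ at *
  rw [mul_add]
  rcases hk with h | h
  · refine le_add_of_nonneg_of_le (by positivity) ?_
    calc U₁ * ka * (V₂ * kb) ≤ (V₁ + R₁) * L * (V₂ * kb) := by gcongr
      _ = _ := by ring
  · refine le_add_of_le_of_nonneg ?_ (by positivity)
    calc U₁ * ka * (V₂ * kb) ≤ U₁ * ka * ((U₂ + R₂) * L) := by gcongr
      _ = _ := by ring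

lemma betaFn_pos {a b : ℝ} (ha : 0 < a) (hb : 0 < b) : 0 < betaFn a b :=
  div_pos (mul_pos (Gamma_pos_of_pos ha) (Gamma_pos_of_pos hb)) (Gamma_pos_of_pos (add_pos ha hb))

/-- The space integral of the product of the two kernels at an intermediate time. -/
lemma exists_lintegral_rho_mul_rho_le
    (d : ℕ) (α₁ α₂ : ℝ) (h1 : 0 < α₁) (h12 : α₁ ≤ α₂)
    (α : EuclideanSpace ℝ (Fin d) → ℝ) (hαb : ∀ x, α x ∈ Icc α₁ α₂)
    (c₁ β₁ : ℝ) (hc₁ : 0 < c₁) (hβ₁ : 0 < β₁)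
    (hαH : ∀ x y, |α x - α y| ≤ c₁ * min (‖x - y‖ ^ β₁) 1)
    (θ₁ θ₂ σ₁ σ₂ : ℝ) (hσ₁ : σ₁ ∈ Ioo (0 : ℝ) 1) (hσ₂ : σ₂ ∈ Ioo (0 : ℝ) 1)
    (hσ : σ₁ + σ₂ < α₂) :
    ∃ C > 0, ∀ t ∈ Ioc (0 : ℝ) 1, ∀ s ∈ Ioo 0 t, ∀ x y : EuclideanSpace ℝ (Fin d),
      (∫⁻ z, ENNReal.ofReal
          (rho d α α₁ θ₁ z σ₁ (t - s) (x - z) * rho d α α₁ θ₂ y σ₂ s (z - y))) ≤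
        ENNReal.ofReal (C * kernelProfile d α₁ (α y) t ‖x - y‖ *
          ((s ^ θ₂ * (t - s) ^ (θ₁ + (σ₁ + σ₂) / α₂ - 1) +
              min (‖x - y‖ ^ σ₂) 1 * (s ^ θ₂ * (t - s) ^ (θ₁ + σ₁ / α₂ - 1))) +
            (s ^ (θ₂ + (σ₁ + σ₂) / α₂ - 1) * (t - s) ^ θ₁ +
              min (‖x - y‖ ^ σ₁) 1 * (s ^ (θ₂ + σ₂ / α₂ - 1) * (t - s) ^ θ₁)))) := by
  obtain ⟨H, hH, hHle⟩ := exists_kernelProfile_le_of_abs_sub_le (D := d) (α₂ := α₂)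
    d.cast_nonneg h1 hc₁.le hβ₁
  obtain ⟨S, hS, hSle⟩ := exists_kernelProfile_le_or_le (D := d) (α₂ := α₂)
    d.cast_nonneg h1 (h1.trans_le h12) hc₁.le hβ₁
  obtain ⟨I, hI, hIle⟩ := exists_lintegral_kernelProfile_le (d := d) (β := σ₁ + σ₂) h1 h12
    (add_pos hσ₁.1 hσ₂.1) hσ
  obtain ⟨I₁, hI₁, hIle₁⟩ := exists_lintegral_kernelProfile_le (d := d) (β := σ₁) h1 h12
    hσ₁.1 (by linarith [hσ₂.1])
  obtain ⟨I₂, hI₂, hIle₂⟩ := exists_lintegral_kernelProfile_le (d := d) (β := σ₂) h1 h12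
    hσ₂.1 (by linarith [hσ₁.1])
  refine ⟨H * S * (I + I₁ + I₂), by positivity, ?_⟩
  rintro t ⟨ht, ht1⟩ s ⟨hs, hst⟩ x y
  have hw : 0 < t - s := sub_pos.2 hst
  have hsI : s ∈ Ioc (0 : ℝ) 1 := ⟨hs, by linarith⟩
  have hwI : t - s ∈ Ioc (0 : ℝ) 1 := ⟨hw, by linarith⟩
  set K := kernelProfile d α₁ (α y) t ‖x - y‖
  have hK : 0 ≤ K := kernelProfile_nonneg ht.le (norm_nonneg _)
  set R₁ := min (‖x - y‖ ^ σ₁) 1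
  set R₂ := min (‖x - y‖ ^ σ₂) 1
  have hR₁ : 0 ≤ R₁ := by positivity
  have hR₂ : 0 ≤ R₂ := by positivity
  have hpoint : ∀ z, rho d α α₁ θ₁ z σ₁ (t - s) (x - z) * rho d α α₁ θ₂ y σ₂ s (z - y) ≤
      H * S * K * (s ^ θ₂ * (t - s) ^ θ₁) *
      ((kernelProfile d α₁ (α x) (t - s) ‖z - x‖ * min (‖z - x‖ ^ (σ₁ + σ₂)) 1 +
          R₂ * (kernelProfile d α₁ (α x) (t - s) ‖z - x‖ * min (‖z - x‖ ^ σ₁) 1)) +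
        (kernelProfile d α₁ (α y) s ‖z - y‖ * min (‖z - y‖ ^ (σ₁ + σ₂)) 1 +
          R₁ * (kernelProfile d α₁ (α y) s ‖z - y‖ * min (‖z - y‖ ^ σ₂) 1))) := by
    intro z
    have hkz := hHle (α z) (hαb z) (α x) (hαb x) (t - s) hwI ‖z - x‖ (norm_nonneg _) (hαH z x)
    have hor := hSle (α x) (hαb x) (α y) (hαb y) s hs (t - s) hw (by linarith)
      ‖x - y‖ ‖z - x‖ ‖z - y‖ (norm_nonneg _) (norm_nonneg _) (norm_nonneg _)
      (by rw [norm_sub_rev z x]; exact norm_sub_le_norm_sub_add_norm_sub x z y) (hαH x y)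
    rw [sub_add_cancel] at hor
    have hka : 0 ≤ kernelProfile d α₁ (α x) (t - s) ‖z - x‖ :=
      kernelProfile_nonneg hw.le (norm_nonneg _)
    have hkb : 0 ≤ kernelProfile d α₁ (α y) s ‖z - y‖ :=
      kernelProfile_nonneg hs.le (norm_nonneg _)
    have hweighted := weighted_mul_le hka hkb (mul_nonneg hS.le hK) (norm_nonneg (z - x))
      (norm_nonneg (z - y)) (norm_nonneg (x - y)) hσ₁ hσ₂
      (by rw [norm_sub_rev x y]; exact norm_sub_le_norm_sub_add_norm_sub z y x)
      (norm_sub_le_norm_sub_add_norm_sub z x y) hor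
    calc rho d α α₁ θ₁ z σ₁ (t - s) (x - z) * rho d α α₁ θ₂ y σ₂ s (z - y)
        = (t - s) ^ θ₁ * min (‖z - x‖ ^ σ₁) 1 * kernelProfile d α₁ (α z) (t - s) ‖z - x‖ *
          (s ^ θ₂ * min (‖z - y‖ ^ σ₂) 1 * kernelProfile d α₁ (α y) s ‖z - y‖) := by
          rw [norm_sub_rev z x]; rfl
      _ ≤ (t - s) ^ θ₁ * min (‖z - x‖ ^ σ₁) 1 *
            (H * kernelProfile d α₁ (α x) (t - s) ‖z - x‖) *
          (s ^ θ₂ * min (‖z - y‖ ^ σ₂) 1 * kernelProfile d α₁ (α y) s ‖z - y‖) := by gcongr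
      _ = H * (s ^ θ₂ * (t - s) ^ θ₁) *
          (min (‖z - x‖ ^ σ₁) 1 * kernelProfile d α₁ (α x) (t - s) ‖z - x‖ *
            (min (‖z - y‖ ^ σ₂) 1 * kernelProfile d α₁ (α y) s ‖z - y‖)) := by ring
      _ ≤ H * (s ^ θ₂ * (t - s) ^ θ₁) * _ := mul_le_mul_of_nonneg_left hweighted (by positivity)
      _ = _ := by ring
  have hmeas : ∀ (a t σ : ℝ) (w : EuclideanSpace ℝ (Fin d)),
      Measurable fun z => kernelProfile d α₁ a t ‖z - w‖ * min (‖z - w‖ ^ σ) 1 := fun a t σ w =>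
    ((measurable_kernelProfile _ _ _ _).comp (by fun_prop)).mul (by fun_prop)
  calc _ ≤ ∫⁻ z, ENNReal.ofReal _ := lintegral_mono fun z => ENNReal.ofReal_le_ofReal (hpoint z)
    _ ≤ ENNReal.ofReal (H * S * K * (s ^ θ₂ * (t - s) ^ θ₁) *
        ((I * (t - s) ^ ((σ₁ + σ₂) / α₂ - 1) + R₂ * (I₁ * (t - s) ^ (σ₁ / α₂ - 1))) +
          (I * s ^ ((σ₁ + σ₂) / α₂ - 1) + R₁ * (I₂ * s ^ (σ₂ / α₂ - 1))))) := by
        refine lintegral_ofReal_const_mul_le (by positivity) (lintegral_ofReal_add_le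
          ((hmeas _ _ _ _).add ((hmeas _ _ _ _).const_mul _)) (by positivity) (by positivity)
          (lintegral_ofReal_add_le (hmeas _ _ _ _) (by positivity) (by positivity)
            (hIle _ (hαb x) _ hwI x)
            (lintegral_ofReal_const_mul_le hR₂ (hIle₁ _ (hαb x) _ hwI x)))
          (lintegral_ofReal_add_le (hmeas _ _ _ _) (by positivity) (by positivity)
            (hIle _ (hαb y) _ hsI y)
            (lintegral_ofReal_const_mul_le hR₁ (hIle₂ _ (hαb y) _ hsI y))))
    _ ≤ _ := by
        apply ENNReal.ofReal_le_ofReal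
        have hsplit : ∀ p θ q : ℝ, 0 < p → p ^ (θ + q - 1) = p ^ θ * p ^ (q - 1) :=
          fun p θ q hp => by rw [add_sub_assoc, rpow_add hp]
        rw [hsplit _ _ _ hw, hsplit _ _ _ hw, hsplit _ _ _ hs, hsplit _ _ _ hs]
        calc _ ≤ H * S * K * (s ^ θ₂ * (t - s) ^ θ₁) *
            (((I + I₁ + I₂) * (t - s) ^ ((σ₁ + σ₂) / α₂ - 1) +
                R₂ * ((I + I₁ + I₂) * (t - s) ^ (σ₁ / α₂ - 1))) +
              ((I + I₁ + I₂) * s ^ ((σ₁ + σ₂) / α₂ - 1) +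
                R₁ * ((I + I₁ + I₂) * s ^ (σ₂ / α₂ - 1)))) := by
              gcongr <;> linarith
          _ = _ := by ring

theorem stmt13
    (d : ℕ) (hd : 1 ≤ d)
    (α₁ α₂ : ℝ) (h1 : 0 < α₁) (h12 : α₁ ≤ α₂) (h2 : α₂ < 2)
    (α : EuclideanSpace ℝ (Fin d) → ℝ) (hαm : Measurable α)
    (hαb : ∀ x, α x ∈ Icc α₁ α₂)
    (c₁ β₁ : ℝ) (hc₁ : 0 < c₁) (hβ₁ : β₁ ∈ Ioc (0:ℝ) 1)
    (hαH : ∀ x y, |α x - α y| ≤ c₁ * min (‖x - y‖ ^ β₁) 1)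
    (θ₁ θ₂ : ℝ) (σ₁ σ₂ : ℝ) (hσ₁ : σ₁ ∈ Ioo (0:ℝ) 1) (hσ₂ : σ₂ ∈ Ioo (0:ℝ) 1)
    (hσ : σ₁ + σ₂ < α₂)
    (hθ₁ : 0 < θ₁ + σ₁ / α₂) (hθ₂ : 0 < θ₂ + σ₂ / α₂) :
    ∃ c > 0, ∀ t ∈ Ioc (0:ℝ) 1, ∀ x y : EuclideanSpace ℝ (Fin d),
      (∫⁻ s in Ioo (0:ℝ) t, ∫⁻ z, ENNReal.ofReal
          (rho d α α₁ θ₁ z σ₁ (t - s) (x - z) * rho d α α₁ θ₂ y σ₂ s (z - y)))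
        ≤ ENNReal.ofReal (c * betaFn (σ₁ / α₂ + θ₁) (σ₂ / α₂ + θ₂) *
            (rho d α α₁ (θ₁ + θ₂ + (σ₁ + σ₂) / α₂) y 0 t (x - y)
            + rho d α α₁ (θ₁ + θ₂ + σ₁ / α₂) y σ₂ t (x - y)
            + rho d α α₁ (θ₁ + θ₂ + σ₂ / α₂) y σ₁ t (x - y))) := by
  have h20 : 0 < α₂ := h1.trans_le h12
  have hfrac₁ : σ₁ / α₂ < 1 := (div_lt_one h20).2 (by linarith [hσ₂.1])
  have hfrac₂ : σ₂ / α₂ < 1 := (div_lt_one h20).2 (by linarith [hσ₁.1])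
  have hpos₁ : 0 < σ₁ / α₂ := div_pos hσ₁.1 h20
  have hpos₂ : 0 < σ₂ / α₂ := div_pos hσ₂.1 h20
  have hsum : (σ₁ + σ₂) / α₂ = σ₁ / α₂ + σ₂ / α₂ := add_div _ _ _
  obtain ⟨C, hC, hCle⟩ := exists_lintegral_rho_mul_rho_le d α₁ α₂ h1 h12 α hαb c₁ β₁ hc₁ hβ₁.1 hαH
    θ₁ θ₂ σ₁ σ₂ hσ₁ hσ₂ hσ
  obtain ⟨J, hJ, hJle⟩ := exists_lintegral_rpow_mul_sub_rpow_le (u := θ₂)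
    (v := θ₁ + (σ₁ + σ₂) / α₂ - 1) (by linarith) (by linarith)
  obtain ⟨J₁, hJ₁, hJle₁⟩ := exists_lintegral_rpow_mul_sub_rpow_le (u := θ₂)
    (v := θ₁ + σ₁ / α₂ - 1) (by linarith) (by linarith)
  obtain ⟨J', hJ', hJle'⟩ := exists_lintegral_rpow_mul_sub_rpow_le
    (u := θ₂ + (σ₁ + σ₂) / α₂ - 1) (v := θ₁) (by linarith) (by linarith)
  obtain ⟨J₂, hJ₂, hJle₂⟩ := exists_lintegral_rpow_mul_sub_rpow_le
    (u := θ₂ + σ₂ / α₂ - 1) (v := θ₁) (by linarith) (by linarith)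
  have hB : 0 < betaFn (σ₁ / α₂ + θ₁) (σ₂ / α₂ + θ₂) := betaFn_pos (by linarith) (by linarith)
  set B := betaFn (σ₁ / α₂ + θ₁) (σ₂ / α₂ + θ₂)
  refine ⟨C * (J + J' + (J₁ + J₂)) / B, by positivity, ?_⟩
  rintro t ⟨ht, ht1⟩ x y
  set K := kernelProfile d α₁ (α y) t ‖x - y‖
  have hK : 0 ≤ K := kernelProfile_nonneg ht.le (norm_nonneg _)
  set R₁ := min (‖x - y‖ ^ σ₁) 1
  set R₂ := min (‖x - y‖ ^ σ₂) 1
  have hR₁ : 0 ≤ R₁ := by positivity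
  have hR₂ : 0 ≤ R₂ := by positivity
  have hrho : ∀ γ β, rho d α α₁ γ y β t (x - y) = t ^ γ * min (‖x - y‖ ^ β) 1 * K :=
    fun γ β => rfl
  calc _ ≤ ∫⁻ s in Ioo (0 : ℝ) t, ENNReal.ofReal _ :=
        setLIntegral_mono' measurableSet_Ioo fun s hs => hCle t ⟨ht, ht1⟩ s hs x y
    _ ≤ ENNReal.ofReal (C * K *
          ((J * t ^ (θ₂ + (θ₁ + (σ₁ + σ₂) / α₂ - 1) + 1) +
              R₂ * (J₁ * t ^ (θ₂ + (θ₁ + σ₁ / α₂ - 1) + 1))) +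
            (J' * t ^ (θ₂ + (σ₁ + σ₂) / α₂ - 1 + θ₁ + 1) +
              R₁ * (J₂ * t ^ (θ₂ + σ₂ / α₂ - 1 + θ₁ + 1))))) := by
        refine lintegral_ofReal_const_mul_le (by positivity) (lintegral_ofReal_add_le
          (by fun_prop) (by positivity) (by positivity)
          (lintegral_ofReal_add_le (by fun_prop) (by positivity) (by positivity) (hJle t ht)
            (lintegral_ofReal_const_mul_le hR₂ (hJle₁ t ht)))
          (lintegral_ofReal_add_le (by fun_prop) (by positivity) (by positivity) (hJle' t ht)
            (lintegral_ofReal_const_mul_le hR₁ (hJle₂ t ht))))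
    _ ≤ _ := by
        apply ENNReal.ofReal_le_ofReal
        rw [div_mul_cancel₀ _ hB.ne', hrho, hrho, hrho, rpow_zero, min_self, mul_one,
          show θ₂ + (θ₁ + (σ₁ + σ₂) / α₂ - 1) + 1 = θ₁ + θ₂ + (σ₁ + σ₂) / α₂ by ring,
          show θ₂ + (θ₁ + σ₁ / α₂ - 1) + 1 = θ₁ + θ₂ + σ₁ / α₂ by ring,
          show θ₂ + (σ₁ + σ₂) / α₂ - 1 + θ₁ + 1 = θ₁ + θ₂ + (σ₁ + σ₂) / α₂ by ring,
          show θ₂ + σ₂ / α₂ - 1 + θ₁ + 1 = θ₁ + θ₂ + σ₂ / α₂ by ring]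
        set e := t ^ (θ₁ + θ₂ + (σ₁ + σ₂) / α₂)
        set e₁ := t ^ (θ₁ + θ₂ + σ₁ / α₂)
        set e₂ := t ^ (θ₁ + θ₂ + σ₂ / α₂)
        have he : 0 < e := rpow_pos_of_pos ht _
        have he₁ : 0 < e₁ := rpow_pos_of_pos ht _
        have he₂ : 0 < e₂ := rpow_pos_of_pos ht _
        calc C * K * (J * e + R₂ * (J₁ * e₁) + (J' * e + R₁ * (J₂ * e₂)))
            = C * K * ((J + J') * e + J₁ * (e₁ * R₂) + J₂ * (e₂ * R₁)) := by ring
          _ ≤ C * K * ((J + J' + (J₁ + J₂)) * e + (J + J' + (J₁ + J₂)) * (e₁ * R₂) +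
              (J + J' + (J₁ + J₂)) * (e₂ * R₁)) := by
            gcongr ?_ * (?_ * ?_ + ?_ * ?_ + ?_ * ?_) <;> linarith
          _ = _ := by ring
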